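/- Let A be an s×s non-singular by columns (NSC) matrix over the finite field F_q (in particular A is invertible). Then Q·(A^{-1})^T is NSC. -/

import Mathlib

open Matrix Finset Kronecker

variable {F : Type} [Field F] [DecidableEq F]

/-- Entrywise application of the map `π_e : x ↦ x ^ (p ^ e)` to a matrix. -/
def piE (p e : ℕ) {m n : Type} (A : Matrix m n F) : Matrix m n F :=
  A.map fun x => x ^ p ^ e

/-- Entrywise application of `π_e` to a vector. -/
def piEv (p e : ℕ) {n : Type} (v : n → F) : n → F := fun i => v i ^ p ^ e

/-- A monomial matrix: exactly one nonzero entry in each row and each column. -/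
def IsMonomial {n : Type} [Fintype n] (M : Matrix n n F) : Prop :=
  (∀ i, ∃! j, M i j ≠ 0) ∧ (∀ j, ∃! i, M i j ≠ 0)

/-- Non-singular by columns (NSC): for each `ℓ`, every `ℓ × ℓ` submatrix formed by the first
`ℓ` rows and any `ℓ` columns (in increasing order) is non-singular. -/
def IsNSC {s : ℕ} (A : Matrix (Fin s) (Fin s) F) : Prop :=
  ∀ (ℓ : ℕ) (hℓ : ℓ ≤ s) (j : Fin ℓ → Fin s), StrictMono j →
    (Matrix.of fun a b : Fin ℓ => A (Fin.castLE hℓ a) (j b)).det ≠ 0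

/-- Toeplitz matrix: constant along diagonals. -/
def IsToeplitz {s : ℕ} (A : Matrix (Fin s) (Fin s) F) : Prop :=
  ∀ (i j : ℕ) (hi : i + 1 < s) (hj : j + 1 < s),
    A ⟨i, Nat.lt_of_succ_lt hi⟩ ⟨j, Nat.lt_of_succ_lt hj⟩ = A ⟨i + 1, hi⟩ ⟨j + 1, hj⟩

/-- The anti-diagonal matrix `Q` with ones on the anti-diagonal. -/
def antiDiagQ (F : Type) [Field F] (s : ℕ) : Matrix (Fin s) (Fin s) F :=
  Matrix.of fun i j => if (i : ℕ) + (j : ℕ) + 1 = s then 1 else 0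

/-- Dual of a code with respect to the pairing `⟨u, c⟩ = ∑ j, u j * g c j`. -/
def dualWith {n : Type} [Fintype n] (g : (n → F) → n → F) (C : Submodule F (n → F)) :
    Submodule F (n → F) where
  carrier := {u | ∀ c ∈ C, ∑ j, u j * g c j = 0}
  add_mem' := by
    intro a b ha hb c hc
    simp only [Pi.add_apply, add_mul, Finset.sum_add_distrib, ha c hc, hb c hc, add_zero]
  zero_mem' := by
    intro c hc
    simp
  smul_mem' := by
    intro r a ha c hc
    simp only [Pi.smul_apply, smul_eq_mul, mul_assoc, ← Finset.mul_sum, ha c hc, mul_zero]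

/-- The `σ = (M, e)` dual of a linear code. -/
def sigmaDual {n : Type} [Fintype n] (p e : ℕ) (M : Matrix n n F)
    (C : Submodule F (n → F)) : Submodule F (n → F) :=
  dualWith (fun c => Matrix.vecMul (piEv p e c) M) C

/-- The Euclidean dual of a linear code. -/
def euclidDual {n : Type} [Fintype n] (C : Submodule F (n → F)) : Submodule F (n → F) :=
  dualWith id C

/-- The matrix-product code `[C_1, …, C_s] · A`, realized inside `Fin s × Fin n → F`
(block `j` of a codeword is `∑ i, A i j • c i`). -/
def matrixProductCode {n s : ℕ} (C : Fin s → Submodule F (Fin n → F))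
    (A : Matrix (Fin s) (Fin s) F) : Submodule F (Fin s × Fin n → F) where
  carrier := {x | ∃ c : Fin s → Fin n → F, (∀ i, c i ∈ C i) ∧
    ∀ jt : Fin s × Fin n, x jt = ∑ i, A i jt.1 * c i jt.2}
  add_mem' := by
    rintro x y ⟨c, hc, hx⟩ ⟨d, hd, hy⟩
    refine ⟨c + d, fun i => (C i).add_mem (hc i) (hd i), fun jt => ?_⟩
    simp [hx jt, hy jt, mul_add, Finset.sum_add_distrib]
  zero_mem' := ⟨0, fun i => (C i).zero_mem, fun jt => by simp⟩
  smul_mem' := by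
    rintro r x ⟨c, hc, hx⟩
    refine ⟨r • c, fun i => (C i).smul_mem r (hc i), fun jt => ?_⟩
    simp [hx jt, Finset.mul_sum, mul_left_comm]

/-- The minimum distance of the code `C` is at least `d`. -/
def minDistGe {n : Type} [Fintype n] (C : Submodule F (n → F)) (d : ℕ) : Prop :=
  ∀ x ∈ C, x ≠ 0 → d ≤ hammingNorm x

/-- The code `C` has minimum distance exactly `d`. -/
def minDistEq {n : Type} [Fintype n] (C : Submodule F (n → F)) (d : ℕ) : Prop :=
  minDistGe C d ∧ ∃ x ∈ C, x ≠ 0 ∧ hammingNorm x = d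

theorem antiDiagQ_mul_apply {F : Type} [Field F] {s : ℕ} (M : Matrix (Fin s) (Fin s) F)
    (i j : Fin s) : (antiDiagQ F s * M) i j = M i.rev j := by
  rw [Matrix.mul_apply, Finset.sum_eq_single i.rev]
  · have h : (i : ℕ) + (i.rev : ℕ) + 1 = s := by simp only [Fin.val_rev]; omega
    simp only [antiDiagQ, Matrix.of_apply, if_pos h, one_mul]
  · intro k _ hk
    have h : ¬ ((i : ℕ) + (k : ℕ) + 1 = s) := fun h =>
      hk (Fin.ext (by simp only [Fin.val_rev]; omega))
    simp only [antiDiagQ, Matrix.of_apply, if_neg h, zero_mul]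
  · intro h
    exact absurd (Finset.mem_univ _) h

theorem IsNSC.det_ne_zero {F : Type} [Field F] {s : ℕ} {A : Matrix (Fin s) (Fin s) F}
    (hA : IsNSC A) : A.det ≠ 0 :=
  hA s le_rfl id strictMono_id

/-- A vector supported on `T` and killed by the first `#T` rows of an NSC matrix is zero. -/
theorem IsNSC.eq_zero_of_mulVec {F : Type} [Field F] {s : ℕ} {A : Matrix (Fin s) (Fin s) F}
    (hA : IsNSC A) (T : Finset (Fin s)) (x : Fin s → F) (hx : ∀ i ∉ T, x i = 0)
    (h : ∀ i : Fin s, (i : ℕ) < T.card → (A *ᵥ x) i = 0) : x = 0 := by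
  have hT : T.card ≤ s := by simpa using T.card_le_univ
  let e := T.orderEmbOfFin rfl
  have hrange : ∀ i ∉ Set.range e, x i = 0 := fun i hi => hx i fun hiT =>
    hi (by rw [Finset.range_orderEmbOfFin]; exact hiT)
  have hzero : x ∘ e = 0 := by
    refine Matrix.eq_zero_of_mulVec_eq_zero (hA _ hT e e.strictMono) (funext fun a => ?_)
    refine Eq.trans ?_ (h (Fin.castLE hT a) a.isLt)
    exact Fintype.sum_of_injective e e.injective _ _
      (fun i hi => by simp [hrange i hi]) (fun _ => rfl)
  funext i
  by_cases hi : i ∈ Set.range e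
  · obtain ⟨a, rfl⟩ := hi
    exact congrFun hzero a
  · exact hrange i hi

/-- If `A` is NSC (in particular invertible), then `Q · (A⁻¹)ᵀ` is NSC. -/
theorem stmt14 {F : Type} [Field F] [Fintype F] [DecidableEq F]
    {s : ℕ} (A : Matrix (Fin s) (Fin s) F) (hA : IsNSC A) :
    IsNSC (antiDiagQ F s * (A⁻¹)ᵀ) := by
  intro ℓ hℓ j hj hdet
  obtain ⟨v, hv, hvB⟩ := Matrix.exists_vecMul_eq_zero_iff.mpr hdet
  let e : Fin ℓ → Fin s := fun a => (Fin.castLE hℓ a).rev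
  have he : Function.Injective e := Fin.rev_injective.comp (Fin.castLE_injective hℓ)
  let c : Fin s → F := Function.extend e v 0
  have hce : ∀ a, c (e a) = v a := fun a => he.extend_apply v 0 a
  have hc : ∀ i ∉ Set.range e, c i = 0 := fun i hi => Function.extend_apply' v (0 : Fin s → F) i hi
  have hAx : A *ᵥ (A⁻¹ *ᵥ c) = c := by
    rw [Matrix.mulVec_mulVec, Matrix.mul_nonsing_inv A hA.det_ne_zero.isUnit, Matrix.one_mulVec]
  have hx : A⁻¹ *ᵥ c = 0 := by
    refine hA.eq_zero_of_mulVec (Finset.univ.image j)ᶜ _ (fun i hi => ?_) (fun i hi => ?_)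
    · simp only [Finset.mem_compl, not_not, Finset.mem_image, Finset.mem_univ, true_and] at hi
      obtain ⟨b, rfl⟩ := hi
      refine Eq.trans (Eq.symm ?_) (congrFun hvB b)
      refine Fintype.sum_of_injective e he _ _ (fun i hi => by simp [hc i hi]) (fun a => ?_)
      simp only [Matrix.of_apply, antiDiagQ_mul_apply, Matrix.transpose_apply, hce]
      exact mul_comm _ _
    · rw [hAx]
      rw [Finset.card_compl, Finset.card_image_of_injective _ hj.injective, Finset.card_fin,
        Fintype.card_fin] at hi
      refine hc i ?_
      rintro ⟨a, rfl⟩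
      have := a.isLt
      simp only [e, Fin.val_rev, Fin.val_castLE] at hi
      omega
  rw [hx, Matrix.mulVec_zero] at hAx
  exact hv (funext fun a => by rw [← hce, ← hAx]; rfl)
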